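/- For every integer d ≥ 1 and every real α with 0 < α < 2, the infimum of Σ_{y ∈ Z^d, y ≠ 0} (1 − cos(u·y)) / ( ‖y‖₂^{d+α} · ‖u‖₂^{α} ) over all u ∈ R^d with 0 < ‖u‖_∞ ≤ π is strictly positive, where ‖u‖_∞ is the maximum norm. -/

import Mathlib

open MeasureTheory Filter Real Topology

/-- Euclidean (l²) norm of a vector in `Fin d → ℝ`. -/
noncomputable def l2norm {d : ℕ} (u : Fin d → ℝ) : ℝ := Real.sqrt (∑ i, u i ^ 2)

/-- Euclidean norm of a lattice point. -/
noncomputable def zl2 {d : ℕ} (y : Fin d → ℤ) : ℝ := l2norm (fun i => (y i : ℝ))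

/-- The symbol `Σ_{y ≠ 0} (cos(θ·y) − 1)/‖y‖₂^{d+α}` of the long-range random walk. -/
noncomputable def latticeSymbol (d : ℕ) (α : ℝ) (θ : Fin d → ℝ) : ℝ :=
  ∑' y : {y : Fin d → ℤ // y ≠ 0},
    (Real.cos (∑ i, θ i * (y.1 i : ℝ)) - 1) / zl2 y.1 ^ ((d : ℝ) + α)

/-- Transition probability `p_t^{d,α}(0,x)` of the long-range random walk, defined through
the Fourier inversion formula. -/
noncomputable def pTrans (d : ℕ) (α : ℝ) (t : ℝ) (x : Fin d → ℤ) : ℝ :=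
  ((2 * Real.pi) ^ d)⁻¹ *
    ∫ θ in Set.univ.pi (fun _ : Fin d => Set.Icc (-Real.pi) Real.pi),
      Real.exp (t * latticeSymbol d α θ) * Real.cos (∑ i, (x i : ℝ) * θ i)

/-- The constant `G̃^{d,α} = ∫_{R^d} (1 − cos v₁)/‖v‖₂^{d+α} dv`. -/
noncomputable def Gtilde (d : ℕ) (α : ℝ) : ℝ :=
  ∫ v : Fin d → ℝ, (1 - Real.cos (if h : 0 < d then v ⟨0, h⟩ else 0)) / l2norm v ^ ((d : ℝ) + α)

/-- The density `f_t^{d,α}` of the limiting stable law (case `0 < α < 2`). -/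
noncomputable def fDensity (d : ℕ) (α : ℝ) (t : ℝ) (u : Fin d → ℝ) : ℝ :=
  ((2 * Real.pi) ^ d)⁻¹ *
    ∫ θ : Fin d → ℝ, Real.cos (∑ i, θ i * u i) * Real.exp (-(t * l2norm θ ^ α * Gtilde d α))

lemma norm_le_l2norm {d : ℕ} (u : Fin d → ℝ) : ‖u‖ ≤ l2norm u := by
  refine (pi_norm_le_iff_of_nonneg (Real.sqrt_nonneg _)).2 fun i => ?_
  rw [Real.norm_eq_abs]
  exact Real.abs_le_sqrt
    (Finset.single_le_sum (f := fun i => u i ^ 2) (fun j _ => sq_nonneg (u j)) (Finset.mem_univ i))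

lemma l2norm_le_mul_of_abs_le {d : ℕ} (hd : 1 ≤ d) {u : Fin d → ℝ} {r : ℝ} (hr : 0 ≤ r)
    (h : ∀ i, |u i| ≤ r) : l2norm u ≤ d * r := by
  refine Real.sqrt_le_iff.2 ⟨by positivity, ?_⟩
  have hd' : (1 : ℝ) ≤ d := by exact_mod_cast hd
  calc ∑ i, u i ^ 2 ≤ ∑ _i : Fin d, r ^ 2 :=
        Finset.sum_le_sum fun i _ => sq_le_sq' (abs_le.1 (h i)).1 (abs_le.1 (h i)).2
    _ = d * r ^ 2 := by simp
    _ ≤ (d * r) ^ 2 := by nlinarith [mul_nonneg (mul_nonneg (sub_nonneg.2 hd')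
        (Nat.cast_nonneg (α := ℝ) d)) (sq_nonneg r)]

lemma norm_intCast_comp {d : ℕ} (y : Fin d → ℤ) : ‖(fun i => (y i : ℝ))‖ = ‖y‖ := by
  simp [Pi.norm_def, Int.norm_eq_abs, nnnorm]

lemma summable_norm_int_rpow {d : ℕ} {s : ℝ} (hs : d < s) :
    Summable fun y : Fin d → ℤ => ‖(fun i => (y i : ℝ))‖ ^ (-s) := by
  let b := Pi.basisFun ℝ (Fin d)
  let L := Submodule.span ℤ (Set.range b)
  have hmem (y : Fin d → ℤ) : (fun i => (y i : ℝ)) ∈ L := by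
    rw [b.mem_span_iff_repr_mem ℤ]
    intro i
    exact ⟨y i, by simp [b]⟩
  have hrank : Module.finrank ℤ L = d := by
    rw [ZLattice.rank ℝ L]; simp
  have hsum := ZLattice.summable_norm_rpow L (-s) (by rw [hrank]; linarith)
  refine hsum.comp_injective (i := fun y : Fin d → ℤ => (⟨fun i => (y i : ℝ), hmem y⟩ : L)) ?_
  intro y z h
  funext i
  have hi : (y i : ℝ) = z i := congrFun (Subtype.mk.inj h) i
  exact Int.cast_injective hi

lemma one_sub_cos_add_le (a b : ℝ) :
    1 - Real.cos b ≤ 2 * ((1 - Real.cos a) + (1 - Real.cos (a + b))) := by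
  have key (x : ℝ) : 1 - Real.cos x = 2 * Real.sin (x / 2) ^ 2 := by
    have := Real.cos_sq (x / 2)
    rw [mul_div_cancel₀ x two_ne_zero] at this
    rw [Real.sin_sq, this]; ring
  have hb : Real.sin (b / 2) = Real.sin ((a + b) / 2) * Real.cos (a / 2)
      - Real.cos ((a + b) / 2) * Real.sin (a / 2) := by
    rw [← Real.sin_sub]; ring_nf
  have h1 := Real.sin_sq_add_cos_sq (a / 2)
  have h2 := Real.sin_sq_add_cos_sq ((a + b) / 2)
  rw [key, key, key, hb]
  set p := Real.sin (a / 2)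
  set q := Real.cos (a / 2)
  set p' := Real.sin ((a + b) / 2)
  set q' := Real.cos ((a + b) / 2)
  have e1 : p' ^ 2 * q ^ 2 ≤ p' ^ 2 := by nlinarith [mul_nonneg (sq_nonneg p') (sq_nonneg p)]
  have e2 : q' ^ 2 * p ^ 2 ≤ p ^ 2 := by nlinarith [mul_nonneg (sq_nonneg p') (sq_nonneg p)]
  nlinarith [sq_nonneg (p' * q + q' * p)]

lemma exists_nat_mul_mem_Icc {r : ℝ} (hr : 0 < r) (hπ : r ≤ Real.pi) :
    ∃ k : ℕ, 1 ≤ k ∧ Real.pi / 2 ≤ k * r ∧ k * r ≤ Real.pi := by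
  have h1 : (1 : ℝ) ≤ Real.pi / r := (one_le_div hr).2 hπ
  have hk : 1 ≤ ⌊Real.pi / r⌋₊ := Nat.le_floor (by simpa using h1)
  refine ⟨⌊Real.pi / r⌋₊, hk, ?_, ?_⟩
  · have h2 := Nat.lt_floor_add_one (Real.pi / r)
    rw [div_lt_iff₀ hr] at h2
    have hk' : (1 : ℝ) ≤ ⌊Real.pi / r⌋₊ := by exact_mod_cast hk
    nlinarith
  · exact (le_div_iff₀ hr).1 (Nat.floor_le (by positivity))

lemma summable_rescaled_symbol {d : ℕ} {α : ℝ} (hα : 0 < α) (u : Fin d → ℝ) :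
    Summable fun y : Fin d → ℤ => (1 - Real.cos (∑ i, u i * (y i : ℝ))) /
      (zl2 y ^ ((d : ℝ) + α) * l2norm u ^ α) := by
  have hu : 0 ≤ l2norm u := Real.sqrt_nonneg _
  have hs : (d : ℝ) < d + α := by linarith
  refine Summable.of_nonneg_of_le (fun y => ?_) (fun y => ?_)
    ((summable_norm_int_rpow hs).mul_left (2 / l2norm u ^ α))
  · have : 0 ≤ zl2 y := Real.sqrt_nonneg _
    exact div_nonneg (by linarith [Real.cos_le_one (∑ i, u i * (y i : ℝ))]) (by positivity)
  · have hle : ‖(fun i => (y i : ℝ))‖ ≤ zl2 y := norm_le_l2norm _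
    rcases eq_or_ne y 0 with rfl | hy
    · simp only [Pi.zero_apply, Int.cast_zero, mul_zero, Finset.sum_const_zero, Real.cos_zero,
        sub_self, zero_div]
      positivity
    · have hpos : 0 < ‖(fun i => (y i : ℝ))‖ := by
        rw [norm_intCast_comp]; exact norm_pos_iff.2 hy
      have hz : 0 < zl2 y := hpos.trans_le hle
      rw [Real.rpow_neg hpos.le, mul_comm (zl2 y ^ _), ← div_div, div_eq_mul_inv (_ / _)]
      gcongr
      linarith [Real.neg_one_le_cos (∑ i, u i * (y i : ℝ))]

lemma le_tsum_rescaled_symbol {d : ℕ} (hd : 1 ≤ d) {α : ℝ} (hα : 0 < α) {u : Fin d → ℝ}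
    (hu : 0 < ‖u‖) (huπ : ‖u‖ ≤ Real.pi) :
    1 / 4 / ((2 * d) ^ ((d : ℝ) + α) * (d * Real.pi) ^ α) ≤
      ∑' y : Fin d → ℤ, (1 - Real.cos (∑ i, u i * (y i : ℝ))) /
        (zl2 y ^ ((d : ℝ) + α) * l2norm u ^ α) := by
  have : Nonempty (Fin d) := ⟨⟨0, hd⟩⟩
  have hd' : (0 : ℝ) < d := by exact_mod_cast hd
  obtain ⟨j, hj⟩ : ∃ j, |u j| = ‖u‖ := by
    obtain ⟨j, hj⟩ := Finite.exists_max fun i => ‖u i‖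
    exact ⟨j, le_antisymm (norm_le_pi_norm u j)
      ((pi_norm_le_iff_of_nonneg (norm_nonneg _)).2 hj)⟩
  obtain ⟨k, hk, hkl, hku⟩ := exists_nat_mul_mem_Icc hu huπ
  have hk0 : (0 : ℝ) < k := by exact_mod_cast hk
  have hu2 : 0 < l2norm u := hu.trans_le (norm_le_l2norm u)
  have hu2le : l2norm u ≤ d * ‖u‖ :=
    l2norm_le_mul_of_abs_le hd hu.le fun i => norm_le_pi_norm u i
  let v : Fin d → ℤ := Pi.single j (k : ℤ)
  let w : (Fin d → ℤ) → ℝ := fun y => (1 - Real.cos (∑ i, u i * (y i : ℝ))) /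
    (zl2 y ^ ((d : ℝ) + α) * l2norm u ^ α)
  have hw : Summable w := summable_rescaled_symbol hα u
  have hw0 (y) : 0 ≤ w y := by
    have : 0 ≤ zl2 y := Real.sqrt_nonneg _
    exact div_nonneg (by linarith [Real.cos_le_one (∑ i, u i * (y i : ℝ))]) (by positivity)
  let B : Finset (Fin d → ℤ) := Fintype.piFinset fun _ => Finset.Icc 1 (k : ℤ)
  have hB : (B.card : ℝ) = (k : ℝ) ^ d := by simp [B]
  have hw' : Summable fun y => w (y + v) := hw.comp_injective (add_left_injective v)
  have hshift : ∑' y, w (y + v) = ∑' y, w y := (Equiv.addRight v).tsum_eq w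
  set D : ℝ := (2 * d * k) ^ ((d : ℝ) + α) * l2norm u ^ α with hD
  have hDpos : 0 < D := by positivity
  have hwge (y : Fin d → ℤ) (h1 : ∀ i, 1 ≤ y i) (h2 : ∀ i, y i ≤ 2 * k) :
      (1 - Real.cos (∑ i, u i * (y i : ℝ))) / D ≤ w y := by
    have hz : 0 < zl2 y := by
      refine lt_of_lt_of_le ?_ (norm_le_l2norm _)
      rw [norm_intCast_comp, norm_pos_iff]
      intro h
      have := h1 j
      simp [h] at this
    have hzle : zl2 y ≤ 2 * d * k := by
      have : zl2 y ≤ d * (2 * k) := l2norm_le_mul_of_abs_le hd (by positivity) fun i => by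
        have a1 : (1 : ℝ) ≤ y i := by exact_mod_cast h1 i
        have a2 : (y i : ℝ) ≤ 2 * k := by exact_mod_cast h2 i
        rw [abs_of_nonneg (by linarith)]
        exact a2
      linarith
    refine div_le_div_of_nonneg_left
      (by linarith [Real.cos_le_one (∑ i, u i * (y i : ℝ))]) (by positivity) ?_
    rw [hD]
    gcongr
  have hsumv (y : Fin d → ℤ) :
      ∑ i, u i * ((y + v) i : ℝ) = ∑ i, u i * (y i : ℝ) + u j * k := by
    have : ∑ i, u i * (v i : ℝ) = u j * k := by
      rw [Finset.sum_eq_single j] <;> simp +contextual [v]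
    rw [← this, ← Finset.sum_add_distrib]
    exact Finset.sum_congr rfl fun i _ => by push_cast [Pi.add_apply]; ring
  have hcos : Real.cos (u j * k) ≤ 0 := by
    rw [← Real.cos_abs, abs_mul, hj, Nat.abs_cast, mul_comm]
    exact Real.cos_nonpos_of_pi_div_two_le_of_le hkl (by linarith [Real.pi_pos])
  have hpair (y) (hy : y ∈ B) : 1 / 2 / D ≤ w y + w (y + v) := by
    simp only [B, Fintype.mem_piFinset, Finset.mem_Icc] at hy
    have hv (i) : 0 ≤ v i ∧ v i ≤ k := by
      by_cases h : i = j
      · subst h; simp [v]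
      · simp [v, h]
    have a1 := hwge y (fun i => (hy i).1) fun i => by have := hy i; omega
    have a2 := hwge (y + v) (fun i => by have := hy i; have := hv i; simp only [Pi.add_apply]; omega)
      fun i => by have := hy i; have := hv i; simp only [Pi.add_apply]; omega
    refine le_trans ?_ (add_le_add a1 a2)
    rw [← add_div, hsumv]
    gcongr
    have := one_sub_cos_add_le (∑ i, u i * (y i : ℝ)) (u j * k)
    linarith
  have hsum : (k : ℝ) ^ d * (1 / 2 / D) ≤ 2 * ∑' y, w y := by
    calc (k : ℝ) ^ d * (1 / 2 / D) = ∑ _y ∈ B, 1 / 2 / D := by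
          rw [Finset.sum_const, nsmul_eq_mul, hB]
      _ ≤ ∑ y ∈ B, (w y + w (y + v)) := Finset.sum_le_sum hpair
      _ = ∑ y ∈ B, w y + ∑ y ∈ B, w (y + v) := Finset.sum_add_distrib
      _ ≤ ∑' y, w y + ∑' y, w (y + v) := add_le_add
          (hw.sum_le_tsum B fun y _ => hw0 y) (hw'.sum_le_tsum B fun y _ => hw0 _)
      _ = 2 * ∑' y, w y := by rw [hshift]; ring
  have hkuπ : k * l2norm u ≤ d * Real.pi := by
    calc k * l2norm u ≤ k * (d * ‖u‖) := by gcongr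
      _ = d * (k * ‖u‖) := by ring
      _ ≤ d * Real.pi := by gcongr
  have hDle : D ≤ (k : ℝ) ^ d * ((2 * d) ^ ((d : ℝ) + α) * (d * Real.pi) ^ α) := by
    calc D = (k : ℝ) ^ d * ((2 * d) ^ ((d : ℝ) + α) * (k * l2norm u) ^ α) := by
          rw [hD, Real.mul_rpow (by positivity) hk0.le, Real.rpow_add hk0, Real.rpow_natCast,
            Real.mul_rpow hk0.le hu2.le]
          ring
      _ ≤ _ := by gcongr
  have hlow : 1 / 2 / ((2 * d) ^ ((d : ℝ) + α) * (d * Real.pi) ^ α) ≤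
      (k : ℝ) ^ d * (1 / 2 / D) := by
    rw [← mul_div_assoc, div_le_div_iff₀ (by positivity) hDpos]
    linarith
  change _ ≤ ∑' y, w y
  calc _ = 1 / 2 / ((2 * d) ^ ((d : ℝ) + α) * (d * Real.pi) ^ α) / 2 := by ring
    _ ≤ _ := by linarith

/-- **Positivity of the infimum of the rescaled symbol**: for `0 < α < 2`, the infimum of
`Σ_{y≠0} (1 − cos(u·y))/(‖y‖₂^{d+α} ‖u‖₂^α)` over `{u ∈ R^d : 0 < ‖u‖_∞ ≤ π}` is strictly
positive.  Here `‖u‖` is the sup (l∞) norm on `Fin d → ℝ`. -/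
theorem rescaled_symbol_inf_pos (d : ℕ) (hd : 1 ≤ d) (α : ℝ) (hα0 : 0 < α) (hα2 : α < 2) :
    0 < sInf ((fun u : Fin d → ℝ =>
        ∑' y : {y : Fin d → ℤ // y ≠ 0},
          (1 - Real.cos (∑ i, u i * (y.1 i : ℝ))) /
            (zl2 y.1 ^ ((d : ℝ) + α) * l2norm u ^ α)) ''
      {u : Fin d → ℝ | 0 < ‖u‖ ∧ ‖u‖ ≤ Real.pi}) := by
  have : Nonempty (Fin d) := ⟨⟨0, hd⟩⟩
  have hd' : (0 : ℝ) < d := by exact_mod_cast hd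
  have hc : 0 < 1 / 4 / ((2 * d) ^ ((d : ℝ) + α) * (d * Real.pi) ^ α) := by positivity
  refine hc.trans_le (le_csInf (Set.Nonempty.image _ ⟨fun _ => 1, ?_⟩) ?_)
  · simp only [Set.mem_ofPred_eq, pi_norm_const, norm_one]
    exact ⟨one_pos, by linarith [Real.pi_gt_three]⟩
  · rintro _ ⟨u, ⟨hu, huπ⟩, rfl⟩
    refine (le_tsum_rescaled_symbol hd hα0 hu huπ).trans_eq ?_
    refine (tsum_subtype_eq_of_support_subset (s := {y : Fin d → ℤ | y ≠ 0}) ?_).symm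
    rintro y hy rfl
    simp at hy
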